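/- Assume the setting of the context: b has least relative degree r in the open set D ⊇ C_b, ξ > 0, E := {x ∈ D : L_g L_f^{r-1} b(x) = 0} ⊆ C_{b,ξ}, h(x) = χ(b(x)/ξ), ψ₀, …, ψ_{r-1} are defined from h and the α's, α_r is another continuously differentiable extended class 𝒦 function, and u : D → ℝ^m is the safety-filter controller u(x) = u_nom(x) + μ(x) L_g ψ_{r-1}(x)ᵀ with μ(x) = 0 if L_g ψ_{r-1}(x) u_nom(x) + α_r(ψ_{r-1}(x)) + L_f ψ_{r-1}(x) ≥ 0 and μ(x) = −(L_g ψ_{r-1}(x) u_nom(x) + α_r(ψ_{r-1}(x)) + L_f ψ_{r-1}(x))/‖L_g ψ_{r-1}(x)‖² otherwise. Let s : ℝ^n → ℝ be a smooth function whose superlevel set C_s = {x : s(x) ≥ 0} satisfies C_s ⊆ C_{b,ξ}. Then the nominal control is recovered on the performance-critical region: u(x) = u_nom(x) for all x ∈ C_s ∩ D. -/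

import Mathlib

/-- Lie derivative of a scalar function `φ` along a vector field `f`. -/
noncomputable def LieD {n : ℕ}
    (f : EuclideanSpace ℝ (Fin n) → EuclideanSpace ℝ (Fin n))
    (φ : EuclideanSpace ℝ (Fin n) → ℝ) : EuclideanSpace ℝ (Fin n) → ℝ :=
  fun x => fderiv ℝ φ x (f x)

open Filter Topology in
/-- A local right inverse of a submersion. -/
lemma exists_local_section {E F : Type*} [NormedAddCommGroup E] [NormedSpace ℝ E]
    [FiniteDimensional ℝ E] [NormedAddCommGroup F] [NormedSpace ℝ F] [FiniteDimensional ℝ F]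
    (Φ : E → F) (Φ' : E →L[ℝ] F) (y : E) (h : HasStrictFDerivAt Φ Φ' y)
    (hs : Function.Surjective Φ') :
    ∃ σ : F → E, ∃ σ' : F →L[ℝ] E, HasFDerivAt σ σ' (Φ y) ∧ σ (Φ y) = y ∧
      ∀ᶠ q in 𝓝 (Φ y), Φ (σ q) = q := by
  have : CompleteSpace F := FiniteDimensional.complete ℝ F
  obtain ⟨R0, hR0⟩ := LinearMap.exists_rightInverse_of_surjective (Φ' : E →ₗ[ℝ] F)
    (LinearMap.range_eq_top.2 hs)
  let R : F →L[ℝ] E := LinearMap.toContinuousLinearMap R0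
  have hR : ∀ q, Φ' (R q) = q := fun q => by
    have := LinearMap.congr_fun hR0 q
    simpa [R] using this
  let G : F → F := fun q => Φ (y + R q)
  have h1 : HasStrictFDerivAt (fun q : F => y + R q) R 0 := R.hasStrictFDerivAt.const_add y
  have hG : HasStrictFDerivAt G ((ContinuousLinearEquiv.refl ℝ F : F ≃L[ℝ] F) : F →L[ℝ] F) 0 := by
    have h2 : HasStrictFDerivAt Φ Φ' ((fun q : F => y + R q) 0) := by simpa using h
    have h3 := h2.comp (0 : F) h1
    convert h3 using 1
    ext q
    simp [hR]
  have hG0 : G 0 = Φ y := by simp [G]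
  have hl := hG.to_localInverse
  have he := hG.eventually_right_inverse
  have hi := hG.localInverse_apply_image
  rw [hG0] at hl he hi
  refine ⟨fun q => y + R (hG.localInverse G _ 0 q), _,
    (R.hasFDerivAt.comp (Φ y) hl.hasFDerivAt).const_add y, ?_, ?_⟩
  · simp [hi]
  · filter_upwards [he] with q hq
    exact hq

open Filter Topology in
/-- Factorization of the derivative of a function of `z 0, …, z k`. -/
lemma factor_deriv {E : Type*} [NormedAddCommGroup E] [NormedSpace ℝ E]
    [FiniteDimensional ℝ E] (W : Set E) (hW : IsOpen W) (z : ℕ → E → ℝ)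
    (hz : ∀ i, ContDiff ℝ (⊤ : ℕ∞) (z i)) (k : ℕ)
    (hsurj : ∀ y ∈ W, ∀ c : ℕ → ℝ, ∃ v, ∀ i ≤ k, fderiv ℝ (z i) y v = c i)
    (ψ : E → ℝ)
    (hQ : ∀ y ∈ W, ∀ y' ∈ W, (∀ i ≤ k, z i y' = z i y) → ψ y' = ψ y)
    (y : E) (hy : y ∈ W) (hd : DifferentiableAt ℝ ψ y) :
    ∃ M : (Fin (k + 1) → ℝ) →L[ℝ] ℝ,
      (∀ y' ∈ W, (∀ i ≤ k, z i y' = z i y) →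
        HasFDerivAt ψ (M.comp (ContinuousLinearMap.pi
          (fun i : Fin (k + 1) => fderiv ℝ (z i) y'))) y') ∧
      ∀ e : ℝ, (∀ y' ∈ W, (∀ i < k, z i y' = z i y) → ψ y' - ψ y = e * (z k y' - z k y)) →
        M (Pi.single (Fin.last k) 1) = e := by
  let Φ : E → (Fin (k + 1) → ℝ) := fun w i => z i w
  have hΦ : ∀ w, HasStrictFDerivAt Φ (ContinuousLinearMap.pi
      (fun i : Fin (k + 1) => fderiv ℝ (z i) w)) w := fun w => by
    rw [hasStrictFDerivAt_pi]
    intro i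
    exact ((hz i).contDiffAt.hasStrictFDerivAt (by simp))
  obtain ⟨σ, σ', hσ, hσy, hσr⟩ := exists_local_section Φ _ y (hΦ y) (by
    intro c
    obtain ⟨v, hv⟩ := hsurj y hy (fun i => if h : i < k + 1 then c ⟨i, h⟩ else 0)
    refine ⟨v, ?_⟩
    ext i
    have := hv i (Nat.lt_succ_iff.1 i.2)
    simpa [Nat.lt_succ_iff.1 i.2] using this)
  have hσW : ∀ᶠ q in 𝓝 (Φ y), σ q ∈ W :=
    hσ.continuousAt.eventually (by rw [hσy]; exact hW.mem_nhds hy)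
  have hd' : HasFDerivAt ψ (fderiv ℝ ψ y) (σ (Φ y)) := by rw [hσy]; exact hd.hasFDerivAt
  have hψσ : HasFDerivAt (ψ ∘ σ) ((fderiv ℝ ψ y).comp σ') (Φ y) := hd'.comp _ hσ
  refine ⟨(fderiv ℝ ψ y).comp σ', ?_, ?_⟩
  · intro y' hy' hyy
    have hEq : Φ y' = Φ y := by
      ext i
      exact hyy i (Nat.lt_succ_iff.1 i.2)
    have h1 : HasFDerivAt (ψ ∘ σ) ((fderiv ℝ ψ y).comp σ') (Φ y') := by rw [hEq]; exact hψσ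
    refine (h1.comp y' (hΦ y').hasFDerivAt).congr_of_eventuallyEq ?_
    have hc : ∀ᶠ w in 𝓝 y', σ (Φ w) ∈ W ∧ Φ (σ (Φ w)) = Φ w := by
      have : Tendsto Φ (𝓝 y') (𝓝 (Φ y)) := by
        rw [← hEq]; exact (hΦ y').hasFDerivAt.continuousAt
      exact this.eventually (hσW.and hσr)
    filter_upwards [hc, hW.mem_nhds hy'] with w hw hwW
    refine hQ _ hw.1 _ hwW ?_
    intro i hi
    have := congrFun hw.2 ⟨i, Nat.lt_succ_iff.2 hi⟩
    exact this.symm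
  · intro e he
    let l : ℝ → (Fin (k + 1) → ℝ) := fun t => Φ y + t • Pi.single (Fin.last k) 1
    have hl : HasDerivAt l (Pi.single (Fin.last k) 1) 0 := by
      have := ((hasDerivAt_id (0 : ℝ)).smul_const
        (Pi.single (Fin.last k) 1 : Fin (k + 1) → ℝ)).const_add (Φ y)
      simpa [l] using this
    have hl0 : l 0 = Φ y := by simp [l]
    have h1 : HasDerivAt ((ψ ∘ σ) ∘ l)
        (((fderiv ℝ ψ y).comp σ') (Pi.single (Fin.last k) 1)) 0 := by
      apply HasFDerivAt.comp_hasDerivAt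
      · rw [hl0]; exact hψσ
      · exact hl
    have h2 : HasDerivAt ((ψ ∘ σ) ∘ l) e 0 := by
      have h3 : HasDerivAt (fun t : ℝ => ψ y + e * t) e 0 := by
        simpa using ((hasDerivAt_id (0 : ℝ)).const_mul e).const_add (ψ y)
      refine h3.congr_of_eventuallyEq ?_
      have ht : Tendsto l (𝓝 0) (𝓝 (Φ y)) := by
        rw [← hl0]; exact hl.continuousAt
      filter_upwards [ht.eventually (hσW.and hσr)] with t ht
      have hzi : ∀ i : Fin (k + 1), z i (σ (l t)) = l t i := fun i => congrFun ht.2 i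
      have h4 := he _ ht.1 (by
        intro i hi
        have := hzi ⟨i, by omega⟩
        have hne : (⟨i, by omega⟩ : Fin (k + 1)) ≠ Fin.last k := by
          intro hh
          have := congrArg Fin.val hh
          simp at this
          omega
        simpa [l, Φ, hne] using this)
      have h5 := hzi (Fin.last k)
      simp [l, Φ] at h5
      have h6 : z k (σ (l t)) - z k y = t := by
        simp only [l, Φ]
        linarith
      rw [h6] at h4
      simp only [Function.comp]
      linarith
    exact h1.unique h2

lemma lieD_smooth {n : ℕ} (f : EuclideanSpace ℝ (Fin n) → EuclideanSpace ℝ (Fin n))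
    (hf : ContDiff ℝ (⊤ : ℕ∞) f) (φ : EuclideanSpace ℝ (Fin n) → ℝ)
    (hφ : ContDiff ℝ (⊤ : ℕ∞) φ) : ContDiff ℝ (⊤ : ℕ∞) (LieD f φ) := by
  unfold LieD
  exact (hφ.fderiv_right (m := (⊤ : ℕ∞)) (by simp)).clm_apply hf

lemma lieD_bracket {n : ℕ} (f G : EuclideanSpace ℝ (Fin n) → EuclideanSpace ℝ (Fin n))
    (hf : ContDiff ℝ (⊤ : ℕ∞) f) (hG : ContDiff ℝ (⊤ : ℕ∞) G)
    (φ : EuclideanSpace ℝ (Fin n) → ℝ)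
    (hφ : ContDiff ℝ (⊤ : ℕ∞) φ) (x : EuclideanSpace ℝ (Fin n)) :
    fderiv ℝ φ x (VectorField.lieBracket ℝ f G x) =
      fderiv ℝ (LieD G φ) x (f x) - fderiv ℝ (LieD f φ) x (G x) := by
  have hd : DifferentiableAt ℝ (fderiv ℝ φ) x :=
    ((hφ.fderiv_right (m := (⊤ : ℕ∞)) (by simp)).differentiable (by simp)) x
  have key : ∀ V : EuclideanSpace ℝ (Fin n) → EuclideanSpace ℝ (Fin n),
      ContDiff ℝ (⊤ : ℕ∞) V → ∀ w, fderiv ℝ (LieD V φ) x w =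
        fderiv ℝ φ x (fderiv ℝ V x w) + fderiv ℝ (fderiv ℝ φ) x w (V x) := by
    intro V hV w
    have hVd : DifferentiableAt ℝ V x := (hV.differentiable (by simp)) x
    unfold LieD
    rw [fderiv_clm_apply hd hVd]
    simp
  have hsymm : IsSymmSndFDerivAt ℝ φ x :=
    hφ.contDiffAt.isSymmSndFDerivAt (by
      simp only [minSmoothness_of_isRCLikeNormedField]; exact WithTop.coe_le_coe.2 (le_top : (2 : ℕ∞) ≤ ⊤))
  rw [key G hG, key f hf, VectorField.lieBracket, map_sub, hsymm.eq (f x) (G x)]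
  ring

lemma bracket_smooth {n : ℕ} (f G : EuclideanSpace ℝ (Fin n) → EuclideanSpace ℝ (Fin n))
    (hf : ContDiff ℝ (⊤ : ℕ∞) f) (hG : ContDiff ℝ (⊤ : ℕ∞) G) :
    ContDiff ℝ (⊤ : ℕ∞) (VectorField.lieBracket ℝ f G) := by
  unfold VectorField.lieBracket
  exact ((hG.fderiv_right (m := (⊤ : ℕ∞)) (by simp)).clm_apply hf).sub
    ((hf.fderiv_right (m := (⊤ : ℕ∞)) (by simp)).clm_apply hG)

open Filter Topology in
lemma bracket_tower {n r : ℕ} (f G : EuclideanSpace ℝ (Fin n) → EuclideanSpace ℝ (Fin n))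
    (hf : ContDiff ℝ (⊤ : ℕ∞) f) (hG : ContDiff ℝ (⊤ : ℕ∞) G)
    (z : ℕ → EuclideanSpace ℝ (Fin n) → ℝ) (hz : ∀ i, ContDiff ℝ (⊤ : ℕ∞) (z i))
    (hzs : ∀ i, z (i + 1) = LieD f (z i))
    (D : Set (EuclideanSpace ℝ (Fin n))) (hD : IsOpen D)
    (h0 : ∀ k, k + 2 ≤ r → ∀ x ∈ D, fderiv ℝ (z k) x (G x) = 0)
    (y : EuclideanSpace ℝ (Fin n)) (hy : y ∈ D) (hne : fderiv ℝ (z (r - 1)) y (G y) ≠ 0) (j : ℕ) :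
    ∃ V : EuclideanSpace ℝ (Fin n) → EuclideanSpace ℝ (Fin n), ContDiff ℝ (⊤ : ℕ∞) V ∧
      (∀ i, i + j + 2 ≤ r → ∀ x ∈ D, fderiv ℝ (z i) x (V x) = 0) ∧
      ∀ i, i + j + 1 = r → fderiv ℝ (z i) y (V y) ≠ 0 := by
  induction j with
  | zero =>
    refine ⟨G, hG, fun i hi => h0 i hi, fun i hi => ?_⟩
    have : i = r - 1 := by omega
    rw [this]; exact hne
  | succ j ih =>
    obtain ⟨V, hV, hV0, hV1⟩ := ih
    have hfd : ∀ i, i + j + 2 ≤ r → ∀ x ∈ D, fderiv ℝ (LieD V (z i)) x (f x) = 0 := by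
      intro i hi x hx
      have : LieD V (z i) =ᶠ[𝓝 x] fun _ => (0 : ℝ) := by
        filter_upwards [hD.mem_nhds hx] with w hw
        exact hV0 i hi w hw
      rw [this.fderiv_eq]
      simp
    refine ⟨_, bracket_smooth f V hf hV, ?_, ?_⟩
    · intro i hi x hx
      rw [lieD_bracket f V hf hV _ (hz i), hfd i (by omega) x hx, ← hzs,
        hV0 (i + 1) (by omega) x hx]
      simp
    · intro i hi
      rw [lieD_bracket f V hf hV _ (hz i), hfd i (by omega) y hy, ← hzs]
      simpa using hV1 (i + 1) (by omega)

lemma tower_surj {n r : ℕ} (f G : EuclideanSpace ℝ (Fin n) → EuclideanSpace ℝ (Fin n))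
    (hf : ContDiff ℝ (⊤ : ℕ∞) f) (hG : ContDiff ℝ (⊤ : ℕ∞) G)
    (z : ℕ → EuclideanSpace ℝ (Fin n) → ℝ) (hz : ∀ i, ContDiff ℝ (⊤ : ℕ∞) (z i))
    (hzs : ∀ i, z (i + 1) = LieD f (z i))
    (D : Set (EuclideanSpace ℝ (Fin n))) (hD : IsOpen D)
    (h0 : ∀ k, k + 2 ≤ r → ∀ x ∈ D, fderiv ℝ (z k) x (G x) = 0)
    (y : EuclideanSpace ℝ (Fin n)) (hy : y ∈ D) (hne : fderiv ℝ (z (r - 1)) y (G y) ≠ 0)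
    (c : ℕ → ℝ) (k : ℕ) (hk : k ≤ r) :
    ∃ v, ∀ i < k, fderiv ℝ (z i) y v = c i := by
  induction k with
  | zero => exact ⟨0, fun i hi => absurd hi (Nat.not_lt_zero i)⟩
  | succ k ih =>
    obtain ⟨v, hv⟩ := ih (by omega)
    obtain ⟨V, -, hV0, hV1⟩ := bracket_tower f G hf hG z hz hzs D hD h0 y hy hne (r - 1 - k)
    have h1 := hV1 k (by omega)
    refine ⟨v + ((c k - fderiv ℝ (z k) y v) / fderiv ℝ (z k) y (V y)) • V y, ?_⟩
    intro i hi
    rcases Nat.lt_succ_iff_lt_or_eq.1 hi with hlt | rfl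
    · rw [map_add, map_smul, hV0 i (by omega) y hy, hv i hlt]
      simp
    · rw [map_add, map_smul, smul_eq_mul, div_mul_cancel₀ _ h1]
      ring

/-- Theorem 2, performance-critical property: if the
performance-critical region `C_s = {x | s(x) ≥ 0}` satisfies `C_s ⊆ C_{b,ξ}`,
then the safety-filter controller coincides with the nominal controller on
`C_s ∩ D`. -/
theorem nominal_control_recovery {n m r : ℕ} (hr : 1 ≤ r)
    (f : EuclideanSpace ℝ (Fin n) → EuclideanSpace ℝ (Fin n))
    (hf_lip : LocallyLipschitz f) (hf_smooth : ContDiff ℝ (⊤ : ℕ∞) f)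
    (g : EuclideanSpace ℝ (Fin n) →
      (EuclideanSpace ℝ (Fin m) →L[ℝ] EuclideanSpace ℝ (Fin n)))
    (hg_lip : LocallyLipschitz g) (hg_smooth : ContDiff ℝ (⊤ : ℕ∞) g)
    (b : EuclideanSpace ℝ (Fin n) → ℝ) (hb : ContDiff ℝ (⊤ : ℕ∞) b)
    (D : Set (EuclideanSpace ℝ (Fin n))) (hD : IsOpen D)
    (hCbD : {x | 0 ≤ b x} ⊆ D)
    -- b has least relative degree r in D
    (hreldeg : ∀ k, k + 2 ≤ r → ∀ x ∈ D, ∀ u : EuclideanSpace ℝ (Fin m),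
      fderiv ℝ ((LieD f)^[k] b) x (g x u) = 0)
    (ξ : ℝ) (hξ : 0 < ξ)
    -- E ⊆ C_{b,ξ}
    (hE : {x ∈ D | ∀ u : EuclideanSpace ℝ (Fin m),
        fderiv ℝ ((LieD f)^[r - 1] b) x (g x u) = 0} ⊆ {x | ξ ≤ b x})
    (χ : ℝ → ℝ) (hχ_smooth : ContDiff ℝ r χ) (hχ0 : χ 0 = 0)
    (hχ1 : ∀ τ : ℝ, 1 ≤ τ → χ τ = 1) (hχ' : ∀ τ : ℝ, τ < 1 → 0 < deriv χ τ)
    (h : EuclideanSpace ℝ (Fin n) → ℝ) (hdef : ∀ x, h x = χ (b x / ξ))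
    (α : ℕ → ℝ → ℝ)
    (hα : ∀ k, 1 ≤ k → k ≤ r →
      ContDiff ℝ 1 (α k) ∧ StrictMono (α k) ∧ α k 0 = 0)
    (ψ : ℕ → EuclideanSpace ℝ (Fin n) → ℝ)
    (hψ0 : ψ 0 = h)
    (hψ : ∀ k, k + 2 ≤ r → ∀ x,
      ψ (k + 1) x = LieD f (ψ k) x + α (k + 1) (ψ k x))
    -- the nominal controller: bounded and locally Lipschitz on D
    (unom : EuclideanSpace ℝ (Fin n) → EuclideanSpace ℝ (Fin m))
    (hunom_bdd : ∃ M : ℝ, ∀ x ∈ D, ‖unom x‖ ≤ M)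
    (hunom_lip : LocallyLipschitzOn D unom)
    -- L_g ψ_{r−1} and L_f ψ_{r−1} are locally Lipschitz on D
    (hLg_lip : LocallyLipschitzOn D
      (fun x => (fderiv ℝ (ψ (r - 1)) x).comp (g x)))
    (hLf_lip : LocallyLipschitzOn D (LieD f (ψ (r - 1))))
    -- the KKT multiplier μ and the filtered controller u
    (μ : EuclideanSpace ℝ (Fin n) → ℝ)
    (hμ : ∀ x ∈ D, μ x =
      if 0 ≤ fderiv ℝ (ψ (r - 1)) x (g x (unom x)) + α r (ψ (r - 1) x)
              + LieD f (ψ (r - 1)) x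
      then 0
      else -(fderiv ℝ (ψ (r - 1)) x (g x (unom x)) + α r (ψ (r - 1) x)
              + LieD f (ψ (r - 1)) x)
           / ‖(fderiv ℝ (ψ (r - 1)) x).comp (g x)‖ ^ 2)
    (u : EuclideanSpace ℝ (Fin n) → EuclideanSpace ℝ (Fin m))
    (hu : ∀ x ∈ D, u x = unom x + μ x •
      (InnerProductSpace.toDual ℝ (EuclideanSpace ℝ (Fin m))).symm
        ((fderiv ℝ (ψ (r - 1)) x).comp (g x)))
    -- the performance-critical region C_s ⊆ C_{b,ξ}
    (s : EuclideanSpace ℝ (Fin n) → ℝ) (hs : ContDiff ℝ (⊤ : ℕ∞) s)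
    (hCs : {x | 0 ≤ s x} ⊆ {x | ξ ≤ b x}) :
    ∀ x ∈ {x | 0 ≤ s x} ∩ D, u x = unom x := by
  rintro x ⟨hxs, hxD⟩
  have hbx : ξ ≤ b x := hCs hxs
  suffices hL : (fderiv ℝ (ψ (r - 1)) x).comp (g x) = 0 by
    rw [hu x hxD, hL]; simp
  by_cases hcl : x ∈ closure {y | b y < ξ}
  swap
  · -- locally `h = 1`
    have hev : ∀ᶠ y in nhds x, ξ ≤ b y := by
      rw [mem_closure_iff_frequently, Filter.not_frequently] at hcl
      filter_upwards [hcl] with y hy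
      simpa using hy
    have hconst : ∀ k, k + 1 ≤ r → ∃ c : ℝ, ψ k =ᶠ[nhds x] fun _ => c := by
      intro k
      induction k with
      | zero =>
        intro _
        refine ⟨1, ?_⟩
        filter_upwards [hev] with y hy
        rw [hψ0, hdef]
        exact hχ1 _ ((one_le_div hξ).2 hy)
      | succ k ih =>
        intro hk
        obtain ⟨c, hc⟩ := ih (by omega)
        refine ⟨α (k + 1) c, ?_⟩
        filter_upwards [hc.eventuallyEq_nhds] with y hy
        rw [hψ k (by omega), LieD, hy.fderiv_eq, hy.self_of_nhds]
        simp
    obtain ⟨c, hc⟩ := hconst (r - 1) (by omega)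
    rw [hc.fderiv_eq]
    ext v
    simp
  -- main case
  set z : ℕ → EuclideanSpace ℝ (Fin n) → ℝ := fun i => (LieD f)^[i] b with hzdef
  have hzs : ∀ i, z (i + 1) = LieD f (z i) := fun i => Function.iterate_succ_apply' _ _ _
  have hz : ∀ i, ContDiff ℝ (⊤ : ℕ∞) (z i) := by
    intro i
    induction i with
    | zero => exact hb
    | succ i ih => rw [hzs]; exact lieD_smooth f hf_smooth _ ih
  have hbc : Continuous b := hb.continuous
  set W : Set (EuclideanSpace ℝ (Fin n)) := {y | y ∈ D ∧ b y < ξ} with hWdef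
  have hW : IsOpen W := hD.inter (isOpen_lt hbc continuous_const)
  have hsurj : ∀ k, k + 1 ≤ r → ∀ y ∈ W, ∀ c : ℕ → ℝ,
      ∃ v, ∀ i ≤ k, fderiv ℝ (z i) y v = c i := by
    intro k hk y hy c
    have hex : ∃ w : EuclideanSpace ℝ (Fin m), fderiv ℝ (z (r - 1)) y (g y w) ≠ 0 := by
      by_contra hcon
      push Not at hcon
      have : ξ ≤ b y := hE ⟨hy.1, hcon⟩
      exact absurd hy.2 (not_lt.2 this)
    obtain ⟨w, hw⟩ := hex
    obtain ⟨v, hv⟩ := tower_surj (r := r) f (fun p => g p w) hf_smooth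
      (hg_smooth.clm_apply contDiff_const) z hz hzs D hD
      (fun k hk x hx => hreldeg k hk x hx w) y hy.1 hw c (k + 1) hk
    exact ⟨v, fun i hi => hv i (Nat.lt_succ_iff.2 hi)⟩
  have hr0 : (r : WithTop ℕ∞) ≠ 0 := by
    have : r ≠ 0 := by omega
    exact_mod_cast this
  have hχd : Differentiable ℝ χ := hχ_smooth.differentiable hr0
  have hχc : Continuous (deriv χ) := hχ_smooth.continuous_deriv (by exact_mod_cast hr)
  have hχone : deriv χ 1 = 0 := by
    have hcl1 : IsClosed {t : ℝ | deriv χ t = 0} := isClosed_eq hχc continuous_const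
    have hsub : Set.Ioi (1 : ℝ) ⊆ {t : ℝ | deriv χ t = 0} := by
      intro t ht
      have : χ =ᶠ[nhds t] fun _ => (1 : ℝ) := by
        filter_upwards [Ioi_mem_nhds ht] with q hq
        exact hχ1 q (le_of_lt hq)
      change deriv χ t = 0
      rw [this.deriv_eq]
      simp
    have := hcl1.closure_subset_iff.2 hsub
    rw [closure_Ioi] at this
    exact this (Set.mem_Ici.2 le_rfl)
  let a : EuclideanSpace ℝ (Fin n) → ℝ := fun y => deriv χ (b y / ξ) / ξ
  have hh : ∀ y, HasFDerivAt (ψ 0) (a y • fderiv ℝ b y) y := by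
    intro y
    have h1 : HasFDerivAt b (fderiv ℝ b y) y := (hb.differentiable (by simp) y).hasFDerivAt
    have h2 : HasFDerivAt (fun y => b y / ξ) (ξ⁻¹ • fderiv ℝ b y) y := by
      simpa [div_eq_inv_mul] using h1.const_mul ξ⁻¹
    have h3 := (hχd (b y / ξ)).hasDerivAt.comp_hasFDerivAt y h2
    have h4 : ψ 0 = χ ∘ fun y => b y / ξ := by
      rw [hψ0]; funext y; exact hdef y
    rw [h4]
    have h5 : a y • fderiv ℝ b y = deriv χ (b y / ξ) • ξ⁻¹ • fderiv ℝ b y := by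
      simp only [a, smul_smul, div_eq_mul_inv]
    rw [h5]
    exact h3
  -- the affine structure
  have hT : ∀ k, k + 2 ≤ r → ∀ y ∈ W, ∃ e : ℝ, (e = 0 ∨ e = a y) ∧
      ∀ y' ∈ W, (∀ i < k + 1, z i y' = z i y) →
        ψ (k + 1) y' - ψ (k + 1) y = e * (z (k + 1) y' - z (k + 1) y) := by
    intro k
    induction k with
    | zero =>
      intro hk y hy
      refine ⟨a y, Or.inr rfl, ?_⟩
      intro y' hy' hyy
      have hb0 : b y' = b y := hyy 0 (by omega)
      have ha : a y' = a y := by simp only [a, hb0]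
      have hp : ψ 0 y' = ψ 0 y := by rw [hψ0, hdef, hdef, hb0]
      rw [hψ 0 hk, hψ 0 hk, hp, hzs 0]
      simp only [LieD]
      rw [(hh y).fderiv, (hh y').fderiv, ha]
      simp only [ContinuousLinearMap.smul_apply, smul_eq_mul]
      change _ = a y * (fderiv ℝ b y' (f y') - fderiv ℝ b y (f y))
      ring
    | succ k ih =>
      intro hk y hy
      have ih' := ih (by omega)
      have hQ : ∀ y ∈ W, ∀ y' ∈ W, (∀ i ≤ k + 1, z i y' = z i y) →
          ψ (k + 1) y' = ψ (k + 1) y := by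
        intro y hy y' hy' hyy
        obtain ⟨e, -, he⟩ := ih' y hy
        have := he y' hy' (fun i hi => hyy i (by omega))
        rw [hyy (k + 1) le_rfl, sub_self, mul_zero] at this
        linarith
      obtain ⟨e, he01, he⟩ := ih' y hy
      have hfac := factor_deriv W hW z hz (k + 1) (hsurj (k + 1) (by omega)) (ψ (k + 1)) hQ
      by_cases hd : DifferentiableAt ℝ (ψ (k + 1)) y
      · obtain ⟨M, hM, hMe⟩ := hfac y hy hd
        have hMe := hMe e he
        refine ⟨e, he01, ?_⟩
        intro y' hy' hyy
        have hyy1 : ∀ i ≤ k + 1, z i y' = z i y := fun i hi => hyy i (by omega)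
        rw [hψ (k + 1) hk, hψ (k + 1) hk, hQ y hy y' hy' hyy1]
        simp only [LieD]
        rw [(hM y' hy' hyy1).fderiv, (hM y hy (fun _ _ => rfl)).fderiv]
        have hvec : (ContinuousLinearMap.pi
              (fun i : Fin (k + 1 + 1) => fderiv ℝ (z i) y')) (f y')
            = (ContinuousLinearMap.pi
              (fun i : Fin (k + 1 + 1) => fderiv ℝ (z i) y)) (f y)
            + (z (k + 1 + 1) y' - z (k + 1 + 1) y) • Pi.single (Fin.last (k + 1)) 1 := by
          ext i
          have hzi : ∀ p, fderiv ℝ (z i) p (f p) = z (i + 1) p := fun p => by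
            rw [hzs]; rfl
          simp only [ContinuousLinearMap.coe_pi', Pi.add_apply, Pi.smul_apply, smul_eq_mul, hzi]
          by_cases hi : i = Fin.last (k + 1)
          · subst hi
            simp
          · have hlt : (i : ℕ) < k + 1 := by
              have := i.2
              have : (i : ℕ) ≠ k + 1 := fun hc => hi (Fin.ext hc)
              omega
            rw [hyy (i + 1) (by omega)]
            simp [hi]
        rw [ContinuousLinearMap.comp_apply, ContinuousLinearMap.comp_apply, hvec, map_add,
          map_smul, hMe, smul_eq_mul]
        ring
      · refine ⟨0, Or.inl rfl, ?_⟩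
        intro y' hy' hyy
        have hyy1 : ∀ i ≤ k + 1, z i y' = z i y := fun i hi => hyy i (by omega)
        have hd' : ¬ DifferentiableAt ℝ (ψ (k + 1)) y' := by
          intro hd'
          obtain ⟨M, hM, -⟩ := hfac y' hy' hd'
          exact hd (hM y hy (fun i hi => (hyy1 i hi).symm)).differentiableAt
        rw [hψ (k + 1) hk, hψ (k + 1) hk, hQ y hy y' hy' hyy1]
        simp only [LieD]
        rw [fderiv_zero_of_not_differentiableAt hd, fderiv_zero_of_not_differentiableAt hd']
        simp
  -- the bound on L_g ψ_{r-1}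
  have hbound : ∀ y ∈ W, ∀ v : EuclideanSpace ℝ (Fin m),
      |fderiv ℝ (ψ (r - 1)) y (g y v)| ≤ |a y * fderiv ℝ (z (r - 1)) y (g y v)| := by
    intro y hy v
    obtain ⟨q, rfl⟩ : ∃ q, r = q + 1 := ⟨r - 1, by omega⟩
    simp only [Nat.add_sub_cancel]
    cases q with
    | zero =>
      rw [(hh y).fderiv]
      exact le_of_eq rfl
    | succ k =>
      by_cases hd : DifferentiableAt ℝ (ψ (k + 1)) y
      swap
      · rw [fderiv_zero_of_not_differentiableAt hd]
        simp only [ContinuousLinearMap.zero_apply, abs_zero]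
        exact abs_nonneg _
      have ih' := hT k (by omega)
      have hQ : ∀ y ∈ W, ∀ y' ∈ W, (∀ i ≤ k + 1, z i y' = z i y) →
          ψ (k + 1) y' = ψ (k + 1) y := by
        intro y hy y' hy' hyy
        obtain ⟨e, -, he⟩ := ih' y hy
        have := he y' hy' (fun i hi => hyy i (by omega))
        rw [hyy (k + 1) le_rfl, sub_self, mul_zero] at this
        linarith
      obtain ⟨e, he01, he⟩ := ih' y hy
      obtain ⟨M, hM, hMe⟩ := factor_deriv W hW z hz (k + 1) (hsurj (k + 1) (by omega))
        (ψ (k + 1)) hQ y hy hd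
      have hMe := hMe e he
      have hvec : (ContinuousLinearMap.pi
            (fun i : Fin (k + 1 + 1) => fderiv ℝ (z i) y)) (g y v)
          = (fderiv ℝ (z (k + 1)) y (g y v)) • Pi.single (Fin.last (k + 1)) 1 := by
        ext i
        simp only [ContinuousLinearMap.coe_pi', Pi.smul_apply, smul_eq_mul]
        by_cases hi : i = Fin.last (k + 1)
        · subst hi
          simp
        · have hlt : (i : ℕ) < k + 1 := by
            have := i.2
            have : (i : ℕ) ≠ k + 1 := fun hc => hi (Fin.ext hc)
            omega
          have h0 : fderiv ℝ (z i) y (g y v) = 0 := hreldeg i (by omega) y hy.1 v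
          rw [h0]
          simp [hi]
      rw [(hM y hy (fun _ _ => rfl)).fderiv, ContinuousLinearMap.comp_apply, hvec,
        map_smul, hMe, smul_eq_mul]
      rcases he01 with h0 | h0
      · rw [h0, mul_zero, abs_zero]
        exact abs_nonneg _
      · rw [h0, mul_comm]
  -- pass to the limit
  have hbxe : b x = ξ := by
    refine le_antisymm ?_ hbx
    have : closure {y | b y < ξ} ⊆ {y | b y ≤ ξ} :=
      closure_minimal (fun y (hy : b y < ξ) => (le_of_lt hy : b y ≤ ξ)) (isClosed_le hbc continuous_const)
    exact this hcl
  have hne : (nhdsWithin x {y | b y < ξ}).NeBot := mem_closure_iff_nhdsWithin_neBot.1 hcl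
  ext v
  have hLc : ContinuousAt (fun y => (fderiv ℝ (ψ (r - 1)) y).comp (g y)) x :=
    hLg_lip.continuousOn.continuousAt (hD.mem_nhds hxD)
  have hl1 : Filter.Tendsto (fun y => |fderiv ℝ (ψ (r - 1)) y (g y v)|)
      (nhdsWithin x {y | b y < ξ}) (nhds |fderiv ℝ (ψ (r - 1)) x (g x v)|) := by
    have : ContinuousAt (fun y => ((fderiv ℝ (ψ (r - 1)) y).comp (g y)) v) x :=
      hLc.clm_apply continuousAt_const
    exact (this.abs).tendsto.mono_left nhdsWithin_le_nhds
  have hl2 : Filter.Tendsto (fun y => |a y * fderiv ℝ (z (r - 1)) y (g y v)|)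
      (nhdsWithin x {y | b y < ξ}) (nhds |a x * fderiv ℝ (z (r - 1)) x (g x v)|) := by
    have hac : Continuous a := (hχc.comp (hbc.div_const ξ)).div_const ξ
    have hfc : Continuous (fun y => fderiv ℝ (z (r - 1)) y (g y v)) :=
      ((hz (r - 1)).continuous_fderiv (by simp)).clm_apply
        (hg_smooth.continuous.clm_apply continuous_const)
    exact ((hac.mul hfc).abs.tendsto x).mono_left nhdsWithin_le_nhds
  have hle := le_of_tendsto_of_tendsto hl1 hl2 (by
    filter_upwards [self_mem_nhdsWithin, mem_nhdsWithin_of_mem_nhds (hD.mem_nhds hxD)] with y h1 h2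
    exact hbound y ⟨h2, h1⟩ v)
  have hax : a x = 0 := by
    simp only [a, hbxe, div_self hξ.ne', hχone, zero_div]
  rw [hax, zero_mul, abs_zero] at hle
  have := abs_nonpos_iff.1 hle
  simpa using this
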